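/- Let D=(V,A) be an (S,f)-proper directed graph. There exists a D-canonical set of in-trees covering A if and only if there exists a D*-rooted connector whose size equals opt_D := ∑_{v ∈ V} f(R_D(v)) − (|A| + f(S)). -/

import Mathlib

open Finset

attribute [local instance] Classical.propDecidable

universe u v

/-- One step from `u` to `w` along an arc belonging to `P`. -/
def ArcStep {V E : Type} (tl hd : E → V) (P : Set E) (u w : V) : Prop :=
  ∃ e ∈ P, tl e = u ∧ hd e = w

/-- Directed reachability from `u` to `w` using only arcs in `P`. -/
def ArcReach {V E : Type} (tl hd : E → V) (P : Set E) (u w : V) : Prop :=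
  Relation.ReflTransGen (ArcStep tl hd P) u w

/-- Connectivity in the underlying undirected graph, using only arcs in `P`. -/
def UConn {V E : Type} (tl hd : E → V) (P : Set E) (u w : V) : Prop :=
  Relation.ReflTransGen (fun a b => ArcStep tl hd P a b ∨ ArcStep tl hd P b a) u w

/-- `R_D(v)`: the set of specified vertices (in `S`) reachable from `v`. -/
noncomputable def RD {V E : Type} (tl hd : E → V) (S : Finset V) (v : V) : Finset V :=
  S.filter (fun s => ArcReach tl hd Set.univ v s)

/-- `f(R_D(v))`. -/
noncomputable def fR {V E : Type} (tl hd : E → V) (S : Finset V) (f : V → ℕ) (v : V) : ℕ :=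
  ∑ s ∈ RD tl hd S v, f s

/-- `T` is an in-tree rooted at `root` spanning the vertex set `span`:
every non-root vertex of `span` has a unique outgoing arc in `T`, the root has none,
all arcs stay inside `span`, and every vertex of `span` reaches the root within `T`. -/
structure IsInTree {V E : Type} (tl hd : E → V) (root : V) (span : Set V)
    (T : Finset E) : Prop where
  mem_tail : ∀ e ∈ T, tl e ∈ span
  mem_head : ∀ e ∈ T, hd e ∈ span
  root_mem : root ∈ span
  out_unique : ∀ v ∈ span, v ≠ root → ∃! e, e ∈ T ∧ tl e = v
  root_no_out : ∀ e ∈ T, tl e ≠ root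
  reaches_root : ∀ v ∈ span, ArcReach tl hd (↑T : Set E) v root

/-- Index type for a `D`-canonical family: for each `s ∈ S` there are `f s` indices. -/
def TreeIdx {V : Type} (S : Finset V) (f : V → ℕ) : Type :=
  Σ s : {x : V // x ∈ S}, Fin (f s.1)

noncomputable instance {V : Type} (S : Finset V) (f : V → ℕ) : Fintype (TreeIdx S f) := by
  unfold TreeIdx; infer_instance

/-- The family `T` is a `D`-canonical set of in-trees: for each `s ∈ S` and each
`j < f s`, the corresponding member is an in-tree rooted at `s` spanning the set of
vertices from which `s` is reachable. -/
def IsCanonical {V E : Type} (tl hd : E → V) (S : Finset V) (f : V → ℕ)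
    (T : TreeIdx S f → Finset E) : Prop :=
  ∀ i : TreeIdx S f,
    IsInTree tl hd i.1.1 {v | ArcReach tl hd Set.univ v i.1.1} (T i)

/-- The family covers all arcs. -/
def CoversAll {V E : Type} {S : Finset V} {f : V → ℕ}
    (T : TreeIdx S f → Finset E) : Prop :=
  ∀ e : E, ∃ i, e ∈ T i

/-- The members of the family are pairwise arc-disjoint. -/
def ArcDisjointFam {V E : Type} {S : Finset V} {f : V → ℕ}
    (T : TreeIdx S f → Finset E) : Prop :=
  ∀ i j, i ≠ j → Disjoint (T i) (T j)

/-- Tail map of `D*`: vertices are `Option V` (`none` is the apex `s*`); arcs are the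
arcs of `D` together with, for each `s ∈ S`, `f s` parallel arcs from `s` to `s*`. -/
def starTail {V E : Type} (tl : E → V) (S : Finset V) (f : V → ℕ) :
    E ⊕ TreeIdx S f → Option V :=
  Sum.elim (fun e => some (tl e)) (fun p => some p.1.1)

/-- Head map of `D*`. -/
def starHead {V E : Type} (hd : E → V) (S : Finset V) (f : V → ℕ) :
    E ⊕ TreeIdx S f → Option V :=
  Sum.elim (fun e => some (hd e)) (fun _ => none)

/-- `λ(u,w) ≥ k`: every cut separating `u` from `w` contains at least `k` arcs. -/
def LambdaGe {V' E' : Type} (tl hd : E' → V') (u w : V') (k : ℕ) : Prop :=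
  ∀ W : Set V', u ∈ W → w ∉ W → k ≤ Nat.card {e : E' // tl e ∈ W ∧ hd e ∉ W}

/-- `D` is `(S,f)`-proper: `|δ_{D*}(v)| ≤ f(R_D(v))` for all `v ∈ V`. -/
def IsProper {V E : Type} (tl hd : E → V) (S : Finset V) (f : V → ℕ) : Prop :=
  ∀ v : V,
    Nat.card {e : E ⊕ TreeIdx S f // starTail tl S f e = some v} ≤ fR tl hd S f v

/-- `B` (given by `tB, hB`) is a `D*`-rooted connector:
`λ(v, s*; D* + B) ≥ f(R_D(v))` for every vertex `v`. -/
def IsRootedConnector {V E B : Type} (tl hd : E → V) (S : Finset V) (f : V → ℕ)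
    (tB hB : B → V) : Prop :=
  ∀ v : V,
    LambdaGe (starTail (Sum.elim tl tB) S f) (starHead (Sum.elim hd hB) S f)
      (some v) none (fR tl hd S f v)

/-- Arcs of `B` are parallel to arcs of `A`. -/
def ParallelTo {V E B : Type} (tl hd : E → V) (tB hB : B → V) : Prop :=
  ∀ b : B, ∃ e : E, tl e = tB b ∧ hd e = hB b

/-- Number of arcs of `F` leaving `X`. -/
noncomputable def dOut {V E : Type} (tl hd : E → V) (F : Finset E) (X : Finset V) : ℕ :=
  (F.filter (fun e => tl e ∈ X ∧ hd e ∉ X)).card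

/-- Number of indices whose current set is disjoint from `X`. -/
noncomputable def pDem {V ι : Type} [Fintype ι] (U : ι → Finset V) (X : Finset V) : ℕ :=
  (Finset.univ.filter (fun i => Disjoint X (U i))).card

lemma dOut_submod {V E : Type} (tl hd : E → V) (F : Finset E) (X Y : Finset V) :
    dOut tl hd F (X ∩ Y) + dOut tl hd F (X ∪ Y) ≤ dOut tl hd F X + dOut tl hd F Y := by
  unfold dOut
  simp only [Finset.card_filter, ← Finset.sum_add_distrib]
  apply Finset.sum_le_sum
  intro e _
  simp only [Finset.mem_inter, Finset.mem_union]
  by_cases h1 : tl e ∈ X <;> by_cases h2 : tl e ∈ Y <;> by_cases h3 : hd e ∈ X <;>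
    by_cases h4 : hd e ∈ Y <;> simp [h1, h2, h3, h4]

lemma pDem_supermod {V ι : Type} [Fintype ι] (U : ι → Finset V) (X Y : Finset V) (i₀ : ι)
    (hX : ¬ Disjoint X (U i₀)) (hY : ¬ Disjoint Y (U i₀)) :
    pDem U X + pDem U Y + (if Disjoint (X ∩ Y) (U i₀) then 1 else 0)
      ≤ pDem U (X ∩ Y) + pDem U (X ∪ Y) := by
  unfold pDem
  simp only [Finset.card_filter, ← Finset.sum_add_distrib]
  have h1 : (if Disjoint (X ∩ Y) (U i₀) then 1 else 0) =
      ∑ i : ι, if i = i₀ then (if Disjoint (X ∩ Y) (U i₀) then 1 else 0) else 0 := by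
    rw [Finset.sum_ite_eq']; simp
  rw [h1, ← Finset.sum_add_distrib]
  apply Finset.sum_le_sum
  intro i _
  have hx : Disjoint X (U i) → Disjoint (X ∩ Y) (U i) :=
    fun h => h.mono_left Finset.inter_subset_left
  have hy : Disjoint Y (U i) → Disjoint (X ∩ Y) (U i) :=
    fun h => h.mono_left Finset.inter_subset_right
  have hxy := Finset.disjoint_union_left (s := X) (t := Y) (u := U i)
  simp only [hxy]
  by_cases hi : i = i₀
  · subst hi
    simp [hX, hY]
  · by_cases a : Disjoint X (U i) <;> by_cases b : Disjoint Y (U i) <;> simp_all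

lemma ArcReach.mono_arcs {V E : Type} {tl hd : E → V} {P P' : Set E} (h : P ⊆ P') {u w : V}
    (hr : ArcReach tl hd P u w) : ArcReach tl hd P' u w := by
  refine Relation.ReflTransGen.mono ?_ _ _ hr
  rintro a b ⟨e, he, h1, h2⟩
  exact ⟨e, h he, h1, h2⟩

/-- Core packing lemma (Lovász style proof of Edmonds' theorem). -/
lemma core_packing {V E ι : Type} [Fintype V] [Fintype ι] (tl hd : E → V) (C : Finset V)
    (hC : C.Nonempty) (F : Finset E) :
    ∀ (U : ι → Finset V), (∀ e ∈ F, tl e ∈ C) →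
    (∀ X : Finset V, (X ∩ C).Nonempty → pDem U X ≤ dOut tl hd F X) →
    ∃ T : ι → Finset E, (∀ i, T i ⊆ F) ∧ (∀ i j, i ≠ j → Disjoint (T i) (T j)) ∧
      (∀ i, ∀ e ∈ T i, tl e ∉ U i ∧ (hd e ∈ C ∨ hd e ∈ U i)) ∧
      (∀ i, ∀ u ∈ C, u ∉ U i → ∃! e, e ∈ T i ∧ tl e = u) ∧
      (∀ i, ∀ u ∈ C, ∃ w ∈ U i, ArcReach tl hd (↑(T i) : Set E) u w) := by
  induction F using Finset.strongInduction with
  | H F ih =>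
  intro U hF hcond
  by_cases hall : ∀ i, C ⊆ U i
  · refine ⟨fun _ => ∅, by simp, by simp, by simp, ?_, ?_⟩
    · intro i u hu hnu; exact absurd (hall i hu) hnu
    · intro i u hu; exact ⟨u, hall i hu, Relation.ReflTransGen.refl⟩
  push Not at hall
  obtain ⟨i₀, hi₀⟩ := hall
  -- univ is tight
  have huniv : dOut tl hd F Finset.univ = 0 := by simp [dOut]
  have hpuniv : pDem U Finset.univ = 0 := by
    have := hcond Finset.univ (by simpa using hC)
    omega
  have hU0 : (U i₀).Nonempty := by
    rw [Finset.nonempty_iff_ne_empty]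
    intro h
    have : 0 < pDem U Finset.univ := by
      apply Finset.card_pos.mpr
      exact ⟨i₀, by simp [h]⟩
    omega
  let Tight : Set (Finset V) := {X | dOut tl hd F X = pDem U X ∧ ¬ Disjoint X (U i₀) ∧
    ((X ∩ C) \ U i₀).Nonempty}
  have hTne : Tight.Nonempty := by
    refine ⟨Finset.univ, by omega, ?_, ?_⟩
    · rw [Finset.not_disjoint_iff]
      obtain ⟨w, hw⟩ := hU0
      exact ⟨w, by simp, hw⟩
    · obtain ⟨c, hc, hc'⟩ := Finset.not_subset.mp hi₀
      exact ⟨c, by simp [hc, hc']⟩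
  obtain ⟨X, hX⟩ := (Set.toFinite Tight).exists_minimal hTne
  obtain ⟨⟨hXt, hXU, hXC⟩, hmin⟩ := hX
  have hXC' : ((X \ U i₀) ∩ C).Nonempty := by
    obtain ⟨c, hc⟩ := hXC
    exact ⟨c, by simp at hc ⊢; tauto⟩
  have hlt : dOut tl hd F X < dOut tl hd F (X \ U i₀) := by
    rw [hXt]
    refine lt_of_lt_of_le ?_ (hcond _ hXC')
    apply Finset.card_lt_card
    rw [Finset.ssubset_iff_of_subset]
    · exact ⟨i₀, by simp [Finset.sdiff_disjoint], by simpa using hXU⟩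
    · intro i hi
      simp only [Finset.mem_filter, Finset.mem_univ, true_and] at hi ⊢
      exact hi.mono_left Finset.sdiff_subset
  obtain ⟨e, he, he'⟩ := Finset.exists_mem_notMem_of_card_lt_card hlt
  simp only [Finset.mem_filter, Finset.mem_sdiff, not_and, not_not] at he he'
  obtain ⟨heF, ⟨hu, huU⟩, hh⟩ := he
  have hhX : hd e ∈ X := he' heF hu
  have hhU : hd e ∈ U i₀ := hh hhX
  have huC := hF e heF
  let U' : ι → Finset V := fun i => if i = i₀ then insert (tl e) (U i) else U i
  have hUU' : ∀ i, U i ⊆ U' i := by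
    intro i x hx
    by_cases h : i = i₀ <;> simp [U', h]
    · subst h; exact Or.inr hx
    · exact hx
  have hUsubC : ∀ i x, x ∈ U' i → x ∈ C ∨ x ∈ U i := by
    intro i x hx
    by_cases h : i = i₀
    · simp [U', h] at hx
      subst h
      rcases hx with rfl | hx
      · exact Or.inl huC
      · exact Or.inr hx
    · simp [U', h] at hx
      exact Or.inr hx
  have hcond' : ∀ Y : Finset V, (Y ∩ C).Nonempty → pDem U' Y ≤ dOut tl hd (F.erase e) Y := by
    intro Y hY
    have hle : pDem U' Y ≤ pDem U Y := by
      apply Finset.card_le_card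
      intro i hi
      simp only [Finset.mem_filter, Finset.mem_univ, true_and] at hi ⊢
      exact hi.mono_right (hUU' i)
    have hc := hcond Y hY
    by_cases hleave : tl e ∈ Y ∧ hd e ∉ Y
    · have hd1 : dOut tl hd (F.erase e) Y + 1 = dOut tl hd F Y := by
        unfold dOut
        rw [Finset.filter_erase]
        apply Finset.card_erase_add_one
        simp [heF, hleave]
      by_cases hYU : Disjoint Y (U i₀)
      · have : pDem U' Y < pDem U Y := by
          apply Finset.card_lt_card
          rw [Finset.ssubset_iff_of_subset]
          · refine ⟨i₀, by simpa using hYU, ?_⟩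
            simp [U', hleave.1]
          · intro i hi
            simp only [Finset.mem_filter, Finset.mem_univ, true_and] at hi ⊢
            exact hi.mono_right (hUU' i)
        omega
      · by_contra hcon
        have hYt : dOut tl hd F Y = pDem U Y := by omega
        have h1 := dOut_submod tl hd F X Y
        have h2 := pDem_supermod U X Y i₀ hXU hYU
        have h3 := hcond (X ∩ Y) ⟨tl e, by simp [hu, hleave.1, huC]⟩
        have h4 := hcond (X ∪ Y) ⟨tl e, by simp [hu, huC]⟩
        have hnd : ¬ Disjoint (X ∩ Y) (U i₀) := by
          intro h
          rw [if_pos h] at h2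
          omega
        rw [if_neg hnd] at h2
        have hmem : X ∩ Y ∈ Tight :=
          ⟨by omega, hnd, ⟨tl e, by simp [hu, hleave.1, huC, huU]⟩⟩
        have := hmin hmem Finset.inter_subset_left hhX
        exact hleave.2 (Finset.mem_inter.mp this).2
    · have : dOut tl hd (F.erase e) Y = dOut tl hd F Y := by
        unfold dOut
        rw [Finset.filter_erase, Finset.erase_eq_of_notMem]
        simp only [Finset.mem_filter]; tauto
      omega
  obtain ⟨T, hTF, hTd, hTm, hTu, hTr⟩ := ih (F.erase e) (Finset.erase_ssubset heF) U'
    (fun a ha => hF a (Finset.mem_of_mem_erase ha)) hcond'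
  have heT : ∀ i, e ∉ T i := fun i h => by simpa using hTF i h
  let T' : ι → Finset E := fun i => if i = i₀ then insert e (T i) else T i
  have hTeqA : T' i₀ = insert e (T i₀) := by simp [T']
  have hTeqB : ∀ i, i ≠ i₀ → T' i = T i := by intro i h; simp [T', h]
  have hUeqA : U' i₀ = insert (tl e) (U i₀) := by simp [U']
  have hUeqB : ∀ i, i ≠ i₀ → U' i = U i := by intro i h; simp [U', h]
  refine ⟨T', ?_, ?_, ?_, ?_, ?_⟩
  · intro i a ha
    by_cases h : i = i₀
    · subst h
      rw [hTeqA, Finset.mem_insert] at ha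
      rcases ha with rfl | ha
      · exact heF
      · exact Finset.mem_of_mem_erase (hTF _ ha)
    · rw [hTeqB i h] at ha
      exact Finset.mem_of_mem_erase (hTF _ ha)
  · intro i j hij
    by_cases h : i = i₀
    · subst h
      rw [hTeqA, hTeqB j (Ne.symm hij), Finset.disjoint_insert_left]
      exact ⟨heT j, hTd _ _ hij⟩
    · by_cases h' : j = i₀
      · subst h'
        rw [hTeqA, hTeqB i hij, Finset.disjoint_insert_right]
        exact ⟨heT i, hTd _ _ hij⟩
      · rw [hTeqB i h, hTeqB j h']; exact hTd _ _ hij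
  · intro i a ha
    have key : a ∈ T i → tl a ∉ U i ∧ (hd a ∈ C ∨ hd a ∈ U i) := by
      intro ha
      obtain ⟨h1, h2⟩ := hTm i a ha
      refine ⟨fun h => h1 (hUU' i h), ?_⟩
      rcases h2 with h2 | h2
      · exact Or.inl h2
      · exact hUsubC i _ h2
    by_cases h : i = i₀
    · subst h
      rw [hTeqA, Finset.mem_insert] at ha
      rcases ha with rfl | ha
      · exact ⟨huU, Or.inr hhU⟩
      · exact key ha
    · rw [hTeqB i h] at ha
      exact key ha
  · intro i u huc hunot
    by_cases h : i = i₀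
    · subst h
      rw [hTeqA]
      by_cases hue : u = tl e
      · subst hue
        refine ⟨e, by simp, ?_⟩
        rintro a ⟨ha, hta⟩
        rw [Finset.mem_insert] at ha
        rcases ha with rfl | ha
        · rfl
        · exfalso
          apply (hTm i a ha).1
          rw [hta, hUeqA]; simp
      · obtain ⟨a, ⟨ha, hta⟩, hun⟩ := hTu i u huc (by rw [hUeqA]; simp [hue, hunot])
        refine ⟨a, ⟨by simp [ha], hta⟩, ?_⟩
        rintro b ⟨hb, htb⟩
        rw [Finset.mem_insert] at hb
        rcases hb with rfl | hb
        · exact absurd htb.symm hue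
        · exact hun b ⟨hb, htb⟩
    · rw [hTeqB i h]
      exact hTu i u huc (by rw [hUeqB i h]; exact hunot)
  · intro i u huc
    obtain ⟨w, hw, hr⟩ := hTr i u huc
    by_cases h : i = i₀
    · subst h
      have hr' : ArcReach tl hd (↑(T' i) : Set E) u w := by
        refine hr.mono_arcs ?_
        rw [hTeqA]; simp
      rw [hUeqA, Finset.mem_insert] at hw
      rcases hw with rfl | hw
      · refine ⟨hd e, hhU, Relation.ReflTransGen.tail hr' ⟨e, by rw [hTeqA]; simp, rfl, rfl⟩⟩
      · exact ⟨w, hw, hr'⟩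
    · rw [hTeqB i h]
      rw [hUeqB i h] at hw
      exact ⟨w, hw, hr⟩

/-- Partial family of in-trees on an out-closed set `Q`. -/
structure PartialFam {V E ι : Type} (tl hd : E → V) (root : ι → V) (Q : Finset V)
    (T : ι → Finset E) : Prop where
  disj : ∀ i j, i ≠ j → Disjoint (T i) (T j)
  tailQ : ∀ i, ∀ e ∈ T i, tl e ∈ Q
  tailV : ∀ i, ∀ e ∈ T i, ArcReach tl hd Set.univ (tl e) (root i)
  headV : ∀ i, ∀ e ∈ T i, ArcReach tl hd Set.univ (hd e) (root i)
  noRoot : ∀ i, ∀ e ∈ T i, tl e ≠ root i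
  uniq : ∀ i, ∀ v ∈ Q, ArcReach tl hd Set.univ v (root i) → v ≠ root i →
    ∃! e, e ∈ T i ∧ tl e = v
  reach : ∀ i, ∀ v ∈ Q, ArcReach tl hd Set.univ v (root i) →
    ArcReach tl hd (↑(T i) : Set E) v (root i)

lemma partial_step {V E ι : Type} [Fintype V] [Fintype E] [Fintype ι] (tl hd : E → V)
    (root : ι → V)
    (hcond : ∀ (v : V) (X : Finset V), v ∈ X →
      (Finset.univ.filter (fun i => ArcReach tl hd Set.univ v (root i))).card ≤
        dOut tl hd Finset.univ X + (Finset.univ.filter (fun i => root i ∈ X)).card)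
    (Q : Finset V) (hQ : ∀ e, tl e ∈ Q → hd e ∈ Q) (T : ι → Finset E)
    (hT : PartialFam tl hd root Q T) (hne : Q ≠ Finset.univ) :
    ∃ Q', Q ⊂ Q' ∧ (∀ e, tl e ∈ Q' → hd e ∈ Q') ∧ ∃ T', PartialFam tl hd root Q' T' := by
  let R : V → Finset V := fun v => Finset.univ.filter (fun w => ArcReach tl hd Set.univ v w)
  have hRmem : ∀ v w, w ∈ R v ↔ ArcReach tl hd Set.univ v w := by intro v w; simp [R]
  have hstep : ∀ e, ArcReach tl hd Set.univ (tl e) (hd e) := fun e =>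
    Relation.ReflTransGen.single ⟨e, trivial, rfl, rfl⟩
  have hrefl : ∀ v, ArcReach tl hd Set.univ v v := fun v => Relation.ReflTransGen.refl
  have htrans : ∀ {a b c}, ArcReach tl hd Set.univ a b → ArcReach tl hd Set.univ b c →
    ArcReach tl hd Set.univ a c := fun h1 h2 => Relation.ReflTransGen.trans h1 h2
  have hex : (Qᶜ).Nonempty := by
    rw [Finset.nonempty_iff_ne_empty]; simpa using hne
  obtain ⟨v, hv, hvmin⟩ := Finset.exists_min_image Qᶜ (fun v => (R v).card) hex
  have hvQ : v ∉ Q := by simpa using hv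
  let C : Finset V := R v \ Q
  have hCmem : ∀ w, w ∈ C ↔ ArcReach tl hd Set.univ v w ∧ w ∉ Q := by
    intro w; simp [C, R]
  have hvC : v ∈ C := (hCmem v).2 ⟨hrefl v, hvQ⟩
  have hback : ∀ w ∈ C, ArcReach tl hd Set.univ w v := by
    intro w hw
    obtain ⟨h1, h2⟩ := (hCmem w).1 hw
    have hsub : R w ⊆ R v := by
      intro x hx; rw [hRmem] at hx ⊢; exact htrans h1 hx
    have heq := Finset.eq_of_subset_of_card_le hsub (hvmin w (by simpa using h2))
    rw [← hRmem, heq, hRmem]; exact hrefl v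
  have hCout : ∀ e, tl e ∈ C → hd e ∈ Q ∨ hd e ∈ C := by
    intro e he
    by_cases h : hd e ∈ Q
    · exact Or.inl h
    · exact Or.inr ((hCmem _).2 ⟨htrans ((hCmem _).1 he).1 (hstep e), h⟩)
  let F : Finset E := Finset.univ.filter (fun e => tl e ∈ C)
  let U : ι → Finset V := fun i => Finset.univ.filter (fun x =>
    ArcReach tl hd Set.univ v (root i) →
      (x ∈ Q ∧ ArcReach tl hd Set.univ x (root i)) ∨ (x ∈ C ∧ x = root i))
  have hUmem : ∀ i x, x ∈ U i ↔ (ArcReach tl hd Set.univ v (root i) →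
      (x ∈ Q ∧ ArcReach tl hd Set.univ x (root i)) ∨ (x ∈ C ∧ x = root i)) := by
    intro i x; simp [U]
  have hFcond : ∀ X : Finset V, (X ∩ C).Nonempty → pDem U X ≤ dOut tl hd F X := by
    rintro X ⟨w, hw⟩
    obtain ⟨hwX, hwC⟩ := Finset.mem_inter.mp hw
    let Y : Finset V := Finset.univ.filter (fun z => (z ∈ X ∧ z ∈ C) ∨
      (z ∈ Q ∧ ArcReach tl hd Set.univ v z ∧
        ∀ i, Disjoint X (U i) → ¬ ArcReach tl hd Set.univ z (root i)))
    have hYmem : ∀ z, z ∈ Y ↔ (z ∈ X ∧ z ∈ C) ∨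
      (z ∈ Q ∧ ArcReach tl hd Set.univ v z ∧
        ∀ i, Disjoint X (U i) → ¬ ArcReach tl hd Set.univ z (root i)) := by
      intro z; simp [Y]
    have h1 := hcond w Y ((hYmem w).2 (Or.inl ⟨hwX, hwC⟩))
    have h2 : dOut tl hd Finset.univ Y ≤ dOut tl hd F X := by
      apply Finset.card_le_card
      intro e he
      simp only [Finset.mem_filter, Finset.mem_univ, true_and, F] at he ⊢
      obtain ⟨ht, hh⟩ := he
      rw [hYmem] at ht
      rcases ht with ⟨htX, htC⟩ | ⟨htQ, htr, htn⟩
      · refine ⟨htC, htX, fun hhX => hh ?_⟩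
        rw [hYmem]
        rcases hCout e htC with h | h
        · refine Or.inr ⟨h, htrans ((hCmem _).1 htC).1 (hstep e), ?_⟩
          intro i hi hr
          exact Finset.disjoint_left.mp hi hhX ((hUmem _ _).2 (fun _ => Or.inl ⟨h, hr⟩))
        · exact Or.inl ⟨hhX, h⟩
      · exfalso
        apply hh
        rw [hYmem]
        exact Or.inr ⟨hQ e htQ, htrans htr (hstep e),
          fun i hi hr => htn i hi (htrans (hstep e) hr)⟩
    have h3 : pDem U X + (Finset.univ.filter (fun i => root i ∈ Y)).card ≤
        (Finset.univ.filter (fun i => ArcReach tl hd Set.univ w (root i))).card := by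
      unfold pDem
      rw [← Finset.card_union_of_disjoint]
      · apply Finset.card_le_card
        intro i hi
        simp only [Finset.mem_filter, Finset.mem_univ, true_and, Finset.mem_union] at hi ⊢
        apply htrans (hback w hwC)
        rcases hi with hi | hi
        · by_contra hcon
          exact Finset.disjoint_left.mp hi hwX ((hUmem _ _).2 (fun h => absurd h hcon))
        · rw [hYmem] at hi
          rcases hi with ⟨_, h⟩ | ⟨_, h, _⟩
          · exact ((hCmem _).1 h).1
          · exact h
      · rw [Finset.disjoint_left]
        intro i hi hi'
        simp only [Finset.mem_filter, Finset.mem_univ, true_and] at hi hi'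
        rw [hYmem] at hi'
        rcases hi' with ⟨hx, hc⟩ | ⟨_, _, h⟩
        · exact Finset.disjoint_left.mp hi hx ((hUmem _ _).2 (fun _ => Or.inr ⟨hc, rfl⟩))
        · exact h i hi (hrefl _)
    omega
  obtain ⟨N, hNF, hNd, hNm, hNu, hNr⟩ := core_packing tl hd C ⟨v, hvC⟩ F U
    (fun e he => (Finset.mem_filter.mp he).2) hFcond
  have hNC : ∀ i, ∀ e ∈ N i, tl e ∈ C := fun i e he => (Finset.mem_filter.mp (hNF i he)).2
  have hCQ : ∀ x, x ∈ C → x ∉ Q := fun x hx => ((hCmem x).1 hx).2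
  have hNv : ∀ i, ∀ e ∈ N i, ArcReach tl hd Set.univ v (root i) := by
    intro i e he
    by_contra hcon
    exact (hNm i e he).1 ((hUmem _ _).2 (fun h => absurd h hcon))
  refine ⟨Q ∪ C, ?_, ?_, fun i => T i ∪ N i, ?_⟩
  · rw [Finset.ssubset_iff_of_subset Finset.subset_union_left]
    exact ⟨v, by simp [hvC], hvQ⟩
  · intro e he
    rw [Finset.mem_union] at he ⊢
    rcases he with he | he
    · exact Or.inl (hQ e he)
    · exact hCout e he
  constructor
  · intro i j hij
    have hTN : ∀ a b, Disjoint (T a) (N b) := by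
      intro a b
      rw [Finset.disjoint_left]
      intro e h1 h2
      exact hCQ _ (hNC b e h2) (hT.tailQ a e h1)
    simp only [Finset.disjoint_union_left, Finset.disjoint_union_right]
    exact ⟨⟨hT.disj i j hij, (hTN j i).symm⟩, hTN i j, hNd i j hij⟩
  · intro i e he
    rw [Finset.mem_union] at he ⊢
    rcases he with he | he
    · exact Or.inl (hT.tailQ i e he)
    · exact Or.inr (hNC i e he)
  · intro i e he
    rcases Finset.mem_union.mp he with he | he
    · exact hT.tailV i e he
    · exact htrans (hback _ (hNC i e he)) (hNv i e he)
  · intro i e he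
    rcases Finset.mem_union.mp he with he | he
    · exact hT.headV i e he
    · rcases (hNm i e he).2 with h | h
      · exact htrans (hback _ h) (hNv i e he)
      · rcases (hUmem _ _).1 h (hNv i e he) with h | h
        · exact h.2
        · rw [h.2]; exact hrefl _
  · intro i e he
    rcases Finset.mem_union.mp he with he | he
    · exact hT.noRoot i e he
    · intro h
      exact (hNm i e he).1 ((hUmem _ _).2 (fun _ => Or.inr ⟨hNC i e he, h⟩))
  · intro i x hx hr hxr
    rcases Finset.mem_union.mp hx with hx | hx
    · obtain ⟨e, ⟨he, het⟩, hun⟩ := hT.uniq i x hx hr hxr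
      refine ⟨e, ⟨Finset.mem_union_left _ he, het⟩, ?_⟩
      rintro b ⟨hb, hbt⟩
      rcases Finset.mem_union.mp hb with hb | hb
      · exact hun b ⟨hb, hbt⟩
      · exact absurd hx (hCQ _ (hbt ▸ hNC i b hb))
    · have hvr : ArcReach tl hd Set.univ v (root i) := htrans ((hCmem x).1 hx).1 hr
      have hxU : x ∉ U i := by
        rw [hUmem]
        intro h
        rcases h hvr with h | h
        · exact hCQ x hx h.1
        · exact hxr h.2
      obtain ⟨e, ⟨he, het⟩, hun⟩ := hNu i x hx hxU
      refine ⟨e, ⟨Finset.mem_union_right _ he, het⟩, ?_⟩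
      rintro b ⟨hb, hbt⟩
      rcases Finset.mem_union.mp hb with hb | hb
      · exact absurd (hbt ▸ hT.tailQ i b hb) (hCQ _ hx)
      · exact hun b ⟨hb, hbt⟩
  · intro i x hx hr
    have hTm : (↑(T i) : Set E) ⊆ ↑(T i ∪ N i) := by simp
    have hNsub : (↑(N i) : Set E) ⊆ ↑(T i ∪ N i) := by simp
    rcases Finset.mem_union.mp hx with hx | hx
    · exact (hT.reach i x hx hr).mono_arcs hTm
    · have hvr : ArcReach tl hd Set.univ v (root i) := htrans ((hCmem x).1 hx).1 hr
      obtain ⟨w, hw, hxw⟩ := hNr i x hx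
      rcases (hUmem _ _).1 hw hvr with h | h
      · exact Relation.ReflTransGen.trans (hxw.mono_arcs hNsub) ((hT.reach i w h.1 h.2).mono_arcs hTm)
      · rw [← h.2]; exact hxw.mono_arcs hNsub

/-- Packing of in-trees spanning reachability sets (Kamiyama, Katoh, Takizawa). -/
lemma kkt {V E ι : Type} [Fintype V] [Fintype E] [Fintype ι] (tl hd : E → V)
    (root : ι → V)
    (hcond : ∀ (v : V) (X : Finset V), v ∈ X →
      (Finset.univ.filter (fun i => ArcReach tl hd Set.univ v (root i))).card ≤
        dOut tl hd Finset.univ X + (Finset.univ.filter (fun i => root i ∈ X)).card) :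
    ∃ T : ι → Finset E, (∀ i j, i ≠ j → Disjoint (T i) (T j)) ∧
      ∀ i, IsInTree tl hd (root i) {v | ArcReach tl hd Set.univ v (root i)} (T i) := by
  let G : Set (Finset V) := {Q | (∀ e, tl e ∈ Q → hd e ∈ Q) ∧ ∃ T, PartialFam tl hd root Q T}
  have hG : G.Nonempty := by
    refine ⟨∅, by simp, fun _ => ∅, ?_⟩
    constructor <;> simp
  obtain ⟨Q, ⟨hQ, T, hT⟩, hmax⟩ := (Set.toFinite G).exists_maximal hG
  have hQu : Q = Finset.univ := by
    by_contra hne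
    obtain ⟨Q', hlt, h1, h2⟩ := partial_step tl hd root hcond Q hQ T hT hne
    exact hlt.2 (hmax ⟨h1, h2⟩ hlt.1)
  subst hQu
  refine ⟨T, hT.disj, fun i => ⟨hT.tailV i, hT.headV i, Relation.ReflTransGen.refl, ?_,
    hT.noRoot i, fun v hv => hT.reach i v (by simp) hv⟩⟩
  intro v hv hne
  exact hT.uniq i v (by simp) hv hne

lemma sum_treeIdx {V : Type} (S : Finset V) (f : V → ℕ) (g : V → ℕ) :
    ∑ i : TreeIdx S f, g i.1.1 = ∑ s ∈ S, f s * g s := by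
  have h : ∑ i : TreeIdx S f, g i.1.1 =
      ∑ i : (Σ s : {x : V // x ∈ S}, Fin (f s.1)), g i.1.1 :=
    Fintype.sum_equiv (Equiv.refl _) _ _ (fun _ => rfl)
  rw [h, Fintype.sum_sigma]
  simp only [Finset.sum_const, Finset.card_univ, Fintype.card_fin, smul_eq_mul]
  exact Finset.sum_coe_sort S (fun s => f s * g s)

lemma card_treeIdx {V : Type} (S : Finset V) (f : V → ℕ) :
    Fintype.card (TreeIdx S f) = ∑ s ∈ S, f s := by
  have := sum_treeIdx S f (fun _ => 1)
  simpa using this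

lemma fR_eq_card {V E : Type} (tl hd : E → V) (S : Finset V) (f : V → ℕ) (v : V) :
    fR tl hd S f v = (Finset.univ.filter
      (fun i : TreeIdx S f => ArcReach tl hd Set.univ v i.1.1)).card := by
  rw [Finset.card_filter, sum_treeIdx S f (fun s => if ArcReach tl hd Set.univ v s then 1 else 0)]
  unfold fR RD
  rw [Finset.sum_filter]
  apply Finset.sum_congr rfl
  intro s _
  split_ifs <;> simp

lemma card_inTree {V E : Type} [Fintype V] {tl hd : E → V} {r : V} {P : Set V}
    {T : Finset E} (h : IsInTree tl hd r P T) :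
    T.card + 1 = (Finset.univ.filter (fun v => v ∈ P)).card := by
  rw [← Finset.card_erase_add_one (a := r) (by simpa using h.root_mem)]
  congr 1
  apply Finset.card_bij (fun e _ => tl e)
  · intro e he
    simp [h.mem_tail e he, h.root_no_out e he]
  · intro a ha b hb hab
    obtain ⟨e, _, hun⟩ := h.out_unique (tl a) (h.mem_tail a ha) (h.root_no_out a ha)
    rw [hun a ⟨ha, rfl⟩, hun b ⟨hb, hab.symm⟩]
  · intro v hv
    simp at hv
    obtain ⟨e, ⟨he, het⟩, _⟩ := h.out_unique v hv.2 hv.1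
    exact ⟨e, he, het⟩

lemma card_canonical {V E : Type} [Fintype V] {tl hd : E → V} {S : Finset V} {f : V → ℕ}
    {T : TreeIdx S f → Finset E} (h : IsCanonical tl hd S f T) :
    (∑ i, (T i).card) + ∑ s ∈ S, f s = ∑ v : V, fR tl hd S f v := by
  have h1 : (∑ i, (T i).card) + ∑ s ∈ S, f s = ∑ i, ((T i).card + 1) := by
    rw [Finset.sum_add_distrib]; simp [card_treeIdx]
  rw [h1]
  simp only [fR_eq_card, fun i => card_inTree (h i), Finset.card_filter]
  rw [Finset.sum_comm]
  rfl

lemma card_cut {V E : Type} [Fintype V] [Fintype E] (tl hd : E → V) (S : Finset V) (f : V → ℕ)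
    (X : Finset V) :
    Nat.card {e : E ⊕ TreeIdx S f // starTail tl S f e ∈ (some '' (X : Set V)) ∧
      starHead hd S f e ∉ (some '' (X : Set V))} =
    dOut tl hd Finset.univ X +
      (Finset.univ.filter (fun i : TreeIdx S f => i.1.1 ∈ X)).card := by
  rw [Nat.card_eq_fintype_card, Fintype.card_subtype, Finset.card_filter, Fintype.sum_sum_type]
  unfold dOut
  rw [Finset.card_filter, Finset.card_filter]
  simp [starTail, starHead]

lemma exists_leaving {V E : Type} {tl hd : E → V} {P : Set E} {W : Set V} {u w : V}
    (h : ArcReach tl hd P u w) (hu : u ∈ W) (hw : w ∉ W) :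
    ∃ e ∈ P, tl e ∈ W ∧ hd e ∉ W := by
  induction h with
  | refl => exact absurd hu hw
  | tail _ hs ih =>
    rename_i b c _
    by_cases hb : b ∈ W
    · obtain ⟨e, he, rfl, rfl⟩ := hs
      exact ⟨e, he, hb, hw⟩
    · exact ih hb

lemma stmt5_mp {V A : Type} [Fintype V] [Fintype A]
    (tl hd : A → V) (S : Finset V) (f : V → ℕ)
    (T : TreeIdx S f → Finset A) (hT : IsCanonical tl hd S f T) (hcov : CoversAll T) :
    ∃ (n : ℕ) (tB hB : Fin n → V),
        ParallelTo tl hd tB hB ∧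
        IsRootedConnector tl hd S f tB hB ∧
        (n : ℤ) = (∑ v : V, (fR tl hd S f v : ℤ)) -
          ((Fintype.card A : ℤ) + ∑ s ∈ S, (f s : ℤ)) := by
  choose c hc using hcov
  let B := {p : TreeIdx S f × A // p.2 ∈ T p.1 ∧ p.1 ≠ c p.2}
  let φ : Fin (Fintype.card B) ≃ B := (Fintype.equivFin B).symm
  refine ⟨Fintype.card B, fun b => tl (φ b).1.2, fun b => hd (φ b).1.2, ?_, ?_, ?_⟩
  · intro b
    exact ⟨(φ b).1.2, rfl, rfl⟩
  · intro v W hv hn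
    rw [fR_eq_card, ← Fintype.card_subtype, ← Nat.card_eq_fintype_card]
    let color : (A ⊕ Fin (Fintype.card B)) ⊕ TreeIdx S f → TreeIdx S f :=
      Sum.elim (Sum.elim c (fun b => (φ b).1.1)) id
    have key : ∀ i : {i : TreeIdx S f // ArcReach tl hd Set.univ v i.1.1},
        ∃ e : {e : (A ⊕ Fin (Fintype.card B)) ⊕ TreeIdx S f //
          starTail (Sum.elim tl (fun b => tl (φ b).1.2)) S f e ∈ W ∧
          starHead (Sum.elim hd (fun b => hd (φ b).1.2)) S f e ∉ W}, color e.1 = i.1 := by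
      rintro ⟨i, hi⟩
      by_cases hr : some i.1.1 ∈ W
      · exact ⟨⟨Sum.inr i, hr, hn⟩, rfl⟩
      · obtain ⟨a, ha, hta, hha⟩ := exists_leaving (W := {x | some x ∈ W})
          ((hT i).reaches_root v hi) hv hr
        by_cases hca : c a = i
        · exact ⟨⟨Sum.inl (Sum.inl a), hta, hha⟩, hca⟩
        · let b : B := ⟨(i, a), ha, fun h => hca h.symm⟩
          refine ⟨⟨Sum.inl (Sum.inr (φ.symm b)), ?_, ?_⟩, ?_⟩
          · simpa [starTail, b] using hta
          · simpa [starHead, b] using hha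
          · simp [color, b]
    choose g hg using key
    apply Nat.card_le_card_of_injective g
    intro i j hij
    apply Subtype.ext
    rw [← hg i, ← hg j, hij]
  · have h1 := card_canonical hT
    have h2 : Fintype.card B + Fintype.card A = ∑ i, (T i).card := by
      rw [Fintype.card_subtype, ← Finset.card_univ (α := A)]
      have h3 : (Finset.univ : Finset A).card = (Finset.univ.filter
          (fun p : TreeIdx S f × A => p.2 ∈ T p.1 ∧ p.1 = c p.2)).card := by
        apply Finset.card_bij (fun a _ => (c a, a))
        · intro a _; simp [hc a]
        · intro a _ b _ h; exact (Prod.ext_iff.mp h).2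
        · rintro ⟨i, a⟩ h
          simp at h
          exact ⟨a, by simp, by rw [h.2]⟩
      rw [h3, ← Finset.card_union_of_disjoint, ← Finset.card_sigma]
      · symm
        apply Finset.card_bij (fun (p : Σ _ : TreeIdx S f, A) _ => (p.1, p.2))
        · rintro ⟨i, a⟩ h
          simp at h ⊢
          tauto
        · rintro ⟨i, a⟩ _ ⟨j, b⟩ _ h
          simp at h
          obtain ⟨rfl, rfl⟩ := h
          rfl
        · rintro ⟨i, a⟩ h
          refine ⟨⟨i, a⟩, ?_, rfl⟩
          simp at h ⊢
          tauto
      · rw [Finset.disjoint_left]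
        intro p h h'
        simp at h h'
        exact h.2 h'.2
    have h1' : (∑ i, ((T i).card : ℤ)) + ∑ s ∈ S, (f s : ℤ) = ∑ v : V, (fR tl hd S f v : ℤ) := by
      exact_mod_cast h1
    have h2' : (Fintype.card B : ℤ) + Fintype.card A = ∑ i, ((T i).card : ℤ) := by
      exact_mod_cast h2
    linarith

lemma stmt5_mpr {V A : Type} [Fintype V] [Fintype A]
    (tl hd : A → V) (S : Finset V) (f : V → ℕ) (n : ℕ) (tB hB : Fin n → V)
    (hpar : ParallelTo tl hd tB hB) (hconn : IsRootedConnector tl hd S f tB hB)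
    (hn : (n : ℤ) = (∑ v : V, (fR tl hd S f v : ℤ)) -
          ((Fintype.card A : ℤ) + ∑ s ∈ S, (f s : ℤ))) :
    ∃ T : TreeIdx S f → Finset A, IsCanonical tl hd S f T ∧ CoversAll T := by
  choose π₀ hπt hπh using hpar
  let tl' : A ⊕ Fin n → V := Sum.elim tl tB
  let hd' : A ⊕ Fin n → V := Sum.elim hd hB
  let π : A ⊕ Fin n → A := Sum.elim id π₀
  have ht : ∀ e, tl (π e) = tl' e := by
    rintro (a | b)
    · rfl
    · exact hπt b
  have hh : ∀ e, hd (π e) = hd' e := by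
    rintro (a | b)
    · rfl
    · exact hπh b
  have hreach : ∀ u w, ArcReach tl' hd' Set.univ u w ↔ ArcReach tl hd Set.univ u w := by
    intro u w
    constructor
    · intro h
      refine Relation.ReflTransGen.mono ?_ _ _ h
      rintro a b ⟨e, _, h1, h2⟩
      exact ⟨π e, trivial, (ht e).trans h1, (hh e).trans h2⟩
    · intro h
      refine Relation.ReflTransGen.mono ?_ _ _ h
      rintro a b ⟨e, _, h1, h2⟩
      exact ⟨Sum.inl e, trivial, h1, h2⟩
  have hfR : ∀ v, fR tl' hd' S f v = fR tl hd S f v := by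
    intro v
    unfold fR RD
    simp only [hreach]
  obtain ⟨T', hd1, hT'⟩ := kkt tl' hd' (fun i : TreeIdx S f => i.1.1) (by
    intro v X hv
    have h := hconn v (some '' (X : Set V)) ⟨v, hv, rfl⟩ (by simp)
    rw [← hfR v, fR_eq_card] at h
    rw [card_cut] at h
    exact h)
  have hcan : IsCanonical tl' hd' S f T' := hT'
  have hcount := card_canonical hcan
  simp only [hfR] at hcount
  have hall : (Finset.univ.biUnion T') = Finset.univ := by
    rw [← Finset.card_eq_iff_eq_univ, Finset.card_biUnion (fun i _ j _ hij => hd1 i j hij)]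
    have h1' : (∑ i, ((T' i).card : ℤ)) + ∑ s ∈ S, (f s : ℤ) =
        ∑ v : V, (fR tl hd S f v : ℤ) := by exact_mod_cast hcount
    have : ((∑ i, (T' i).card : ℕ) : ℤ) = (Fintype.card (A ⊕ Fin n) : ℤ) := by
      simp only [Fintype.card_sum, Fintype.card_fin]
      push_cast
      linarith
    exact_mod_cast this
  refine ⟨fun i => (T' i).image π, ?_, ?_⟩
  · intro i
    have hi := hT' i
    constructor
    · intro e he
      obtain ⟨x, hx, rfl⟩ := Finset.mem_image.mp he
      have := hi.mem_tail x hx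
      rw [ht]; exact (hreach _ _).1 this
    · intro e he
      obtain ⟨x, hx, rfl⟩ := Finset.mem_image.mp he
      have := hi.mem_head x hx
      rw [hh]; exact (hreach _ _).1 this
    · exact Relation.ReflTransGen.refl
    · intro v hv hne
      obtain ⟨e, ⟨he, het⟩, hun⟩ := hi.out_unique v ((hreach _ _).2 hv) hne
      refine ⟨π e, ⟨Finset.mem_image_of_mem _ he, (ht e).trans het⟩, ?_⟩
      rintro b ⟨hb, hbt⟩
      obtain ⟨x, hx, rfl⟩ := Finset.mem_image.mp hb
      rw [hun x ⟨hx, (ht x).symm.trans hbt⟩]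
    · intro e he
      obtain ⟨x, hx, rfl⟩ := Finset.mem_image.mp he
      rw [ht]; exact hi.root_no_out x hx
    · intro v hv
      have h := hi.reaches_root v ((hreach _ _).2 hv)
      refine Relation.ReflTransGen.mono ?_ _ _ h
      rintro a b ⟨e, he, h1, h2⟩
      exact ⟨π e, Finset.mem_coe.2 (Finset.mem_image_of_mem _ he),
        (ht e).trans h1, (hh e).trans h2⟩
  · intro e
    have : (Sum.inl e : A ⊕ Fin n) ∈ Finset.univ.biUnion T' := by rw [hall]; simp
    obtain ⟨i, _, hi⟩ := Finset.mem_biUnion.mp this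
    exact ⟨i, Finset.mem_image.mpr ⟨Sum.inl e, hi, rfl⟩⟩

/-- for an `(S,f)`-proper `D`, there exists a `D`-canonical set of
in-trees covering `A` iff there exists a `D*`-rooted connector of size exactly
`opt_D = ∑_{v ∈ V} f(R_D(v)) − (|A| + f(S))`. -/
theorem stmt5 {V A : Type} [Fintype V] [Fintype A]
    (tl hd : A → V) (S : Finset V) (f : V → ℕ)
    (hproper : IsProper tl hd S f) :
    (∃ T : TreeIdx S f → Finset A, IsCanonical tl hd S f T ∧ CoversAll T) ↔
      (∃ (n : ℕ) (tB hB : Fin n → V),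
        ParallelTo tl hd tB hB ∧
        IsRootedConnector tl hd S f tB hB ∧
        (n : ℤ) = (∑ v : V, (fR tl hd S f v : ℤ)) -
          ((Fintype.card A : ℤ) + ∑ s ∈ S, (f s : ℤ))) := by

  constructor
  · rintro ⟨T, hT, hcov⟩
    exact stmt5_mp tl hd S f T hT hcov
  · rintro ⟨n, tB, hB, hpar, hconn, hn⟩
    exact stmt5_mpr tl hd S f n tB hB hpar hconn hn
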